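/- Lemma 19 (resultant-free formulation): Let P be a nonzero polynomial in one variable over ℂ and let Q₁,…,Q_N be polynomials in one variable over ℂ. Then the following are equivalent: (i) there exists t₀ ∈ ℂ with P(t₀) = 0 and Qᵢ(t₀) = 0 for every i = 1,…,N; (ii) for every λ = (λ₁,…,λ_N) ∈ ℂ^N there exists t₀ ∈ ℂ with P(t₀) = 0 and (λ₁Q₁ + ⋯ + λ_N Q_N)(t₀) = 0. (In the paper this is stated as: under the hypothesis that the leading coefficient of P is nonzero, the polynomials P, Q₁,…,Q_N have a common complex root if and only if the resultant R(λ) = Res_{p,q}(P, λ₁Q₁+⋯+λ_NQ_N) vanishes identically as a function of λ; over ℂ, vanishing of the resultant for a given λ is equivalent to P and Q_λ having a common root.) -/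

import Mathlib

/-- Lemma 19 (resultant-free formulation): for a nonzero polynomial `P` and polynomials
`Q₁, …, Q_N` over `ℂ`, the polynomials `P, Q₁, …, Q_N` have a common root iff for every
`λ ∈ ℂᴺ` the polynomials `P` and `λ₁Q₁ + ⋯ + λ_N Q_N` have a common root. -/
theorem lemma19 {N : ℕ} (P : Polynomial ℂ) (hP : P ≠ 0) (Q : Fin N → Polynomial ℂ) :
    (∃ t₀ : ℂ, P.eval t₀ = 0 ∧ ∀ i, (Q i).eval t₀ = 0) ↔
      (∀ l : Fin N → ℂ, ∃ t₀ : ℂ,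
        P.eval t₀ = 0 ∧ (∑ i, Polynomial.C (l i) * Q i).eval t₀ = 0) := by
  constructor
  · rintro ⟨t, hPt, hQt⟩ l
    exact ⟨t, hPt, by simp [Polynomial.eval_finsetSum, hQt]⟩
  · intro h
    -- The kernels of `l ↦ Q_l(t)`, for `t` among the finitely many roots of `P`, cover `ℂᴺ`.
    let K (t : P.roots.toFinset) : Submodule ℂ (Fin N → ℂ) :=
      (Fintype.linearCombination ℂ fun i ↦ (Q i).eval (t : ℂ)).ker
    have hK : ⋃ t, (K t : Set (Fin N → ℂ)) = Set.univ := by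
      refine Set.eq_univ_of_forall fun l ↦ ?_
      obtain ⟨t, hPt, hQt⟩ := h l
      refine Set.mem_iUnion.2 ⟨⟨t, by simp [hP, hPt]⟩, ?_⟩
      simpa [K, Fintype.linearCombination_apply, Polynomial.eval_finsetSum] using hQt
    obtain ⟨⟨t, ht⟩, htop⟩ := Subspace.exists_eq_top_of_iUnion_eq_univ hK
    refine ⟨t, by simpa [hP] using ht, fun i ↦ ?_⟩
    have hi : Pi.single i 1 ∈ K ⟨t, ht⟩ := htop ▸ Submodule.mem_top
    simpa [K] using hi
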